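/- Let d ≥ 2, k ≥ 3, and let s satisfy 1 ≤ s < k/2; write t = k−s, and suppose additionally t ≤ 2k/3 (i.e., s ≥ k/3). Then the chromatic number of the alphabet overlap graph G(k,d,s) is at most 1 + d^{2k−3t} + d^{2t−k}. -/

import Mathlib

/-- The alphabet overlap graph `G(k,d,s)`: vertices are words of length `k` over an
alphabet of size `d`; distinct words `v, w` are adjacent iff the last `k - s` letters of
`v` equal the first `k - s` letters of `w`, or vice versa. -/
def AOGraph (k d s : ℕ) : SimpleGraph (Fin k → Fin d) :=
  SimpleGraph.fromRel fun v w =>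
    ∀ i : Fin (k - s), v ⟨s + i.val, by have := i.isLt; omega⟩
      = w ⟨i.val, by have := i.isLt; omega⟩

/-- The factor of length `l` of the word `v` starting at position `m`. -/
def wordFactor {k d : ℕ} (v : Fin k → Fin d) (m l : ℕ) (h : m + l ≤ k) : Fin l → Fin d :=
  fun i => v ⟨m + i.val, by have := i.isLt; omega⟩

/-- The arc relation of the overlap digraph underlying `AOGraph k d s`. -/
def WordOverlap {k d : ℕ} (s : ℕ) (v w : Fin k → Fin d) : Prop :=
  ∀ i (h : s + i < k), v ⟨s + i, h⟩ = w ⟨i, by omega⟩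

/-- Two words of period `s`, the second overlapping the first, coincide. -/
theorem WordOverlap.eq_of_self {k d s : ℕ} (hs : 2 * s ≤ k) {v w : Fin k → Fin d}
    (hvw : WordOverlap s v w) (hv : WordOverlap s v v) (hw : WordOverlap s w w) : v = w := by
  funext ⟨i, hi⟩
  by_cases h : s + i < k
  · rw [← hv i h, hvw i h]
  · obtain ⟨j, rfl⟩ : ∃ j, i = s + j := ⟨i - s, by omega⟩
    rw [hvw j hi, hw j hi]

open Classical in
/-- Write a word of length `2 * s + b`, `s = b + a`, as `p₁ q₁ p₂ q₂ p₃` with factors of lengths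
`b, a, b, a, b`. Words of period `s` share one color, the other words with `p₂ = p₃` are colored
by `q₂`, and the remaining ones by `p₂`. -/
noncomputable def overlapColor {k d : ℕ} (s a b : ℕ) (hk : k = 2 * s + b) (hs : s = b + a)
    (v : Fin k → Fin d) : Option ((Fin a → Fin d) ⊕ (Fin b → Fin d)) :=
  if WordOverlap s v v then none
  else if wordFactor v s b (by omega) = wordFactor v (2 * s) b (by omega) then
    some (.inl (wordFactor v (s + b) a (by omega)))
  else some (.inr (wordFactor v s b (by omega)))

theorem overlapColor_ne {k d s a b : ℕ} (hk : k = 2 * s + b) (hs : s = b + a)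
    {v w : Fin k → Fin d} (hne : v ≠ w) (hvw : WordOverlap s v w) :
    overlapColor s a b hk hs v ≠ overlapColor s a b hk hs w := by
  have hp : wordFactor w s b (by omega) = wordFactor v (2 * s) b (by omega) := by
    funext i
    simp only [wordFactor, ← hvw (s + i) (by omega), two_mul, add_assoc]
  unfold overlapColor
  split_ifs with hv hw h₁ hvp hw hwp hw hwp <;>
    simp only [ne_eq, reduceCtorEq, not_false_eq_true, not_true_eq_false, Option.some.injEq,
      Sum.inl.injEq, Sum.inr.injEq]
  · exact hne (hvw.eq_of_self (by omega) hv hw)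
  · intro hq
    refine hw fun i h => ?_
    rcases lt_or_ge i b with hib | hib
    · have h₂ := congrFun (hp.trans hvp.symm) ⟨i, hib⟩
      simp only [wordFactor] at h₂
      rw [h₂, hvw i h]
    · rcases lt_or_ge i s with his | his
      · have h₂ := congrFun hq ⟨i - b, by omega⟩
        simp only [wordFactor, show s + b + (i - b) = s + i by omega] at h₂
        rw [← h₂, hvw i h]
      · obtain ⟨j, rfl⟩ : ∃ j, i = s + j := ⟨i - s, by omega⟩
        have h₂ := congrFun hwp ⟨j, by omega⟩
        simp only [wordFactor, two_mul, add_assoc] at h₂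
        exact h₂.symm
  · rwa [hp]

/-- For `d ≥ 2`, `k ≥ 3`, `1 ≤ s < k/2` and `t = k - s ≤ 2k/3`, the chromatic
number of `G(k, d, s)` is at most `1 + d^(2k - 3t) + d^(2t - k)`. -/
theorem aoGraph_chromaticNumber_le' (k d s : ℕ) (hd : 2 ≤ d) (hk : 3 ≤ k)
    (hs1 : 1 ≤ s) (hs2 : 2 * s < k) (ht : 3 * (k - s) ≤ 2 * k) :
    (AOGraph k d s).chromaticNumber
      ≤ (1 + d ^ (2 * k - 3 * (k - s)) + d ^ (2 * (k - s) - k) : ℕ) := by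
  have hA (v w : Fin k → Fin d) (h : ∀ i : Fin (k - s), v ⟨s + i.val, by have := i.isLt; omega⟩
      = w ⟨i.val, by have := i.isLt; omega⟩) : WordOverlap s v w :=
    fun i hi => h ⟨i, by omega⟩
  have hks : k = 2 * s + (2 * (k - s) - k) := by omega
  have hsab : s = (2 * (k - s) - k) + (2 * k - 3 * (k - s)) := by omega
  have hcol := (SimpleGraph.Coloring.mk (G := AOGraph k d s) (overlapColor s _ _ hks hsab)
    fun {v w} hadj => by
      obtain ⟨hne, h | h⟩ := (SimpleGraph.fromRel_adj _ _ _).1 hadj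
      · exact overlapColor_ne hks hsab hne (hA v w h)
      · exact (overlapColor_ne hks hsab hne.symm (hA w v h)).symm).colorable
  convert hcol.chromaticNumber_le using 2
  simp only [Fintype.card_option, Fintype.card_sum, Fintype.card_fun, Fintype.card_fin]
  ring
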